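/- Let T, d be positive integers and let X be a real T × (T·d) matrix whose block transpose 𝒯(X) is nonzero. Then erank(𝒯(X)) ≤ rank(𝒯(X)) ≤ min(T, rank(X) · d). -/

import Mathlib

open scoped BigOperators

/-- Block transpose of a real `T × (T·d)` matrix whose columns are indexed by
pairs `(j, s) ∈ Fin T × Fin d`: `(𝒯X)[i, (j, s)] = X[j, (i, s)]`. -/
def blockT {T d : ℕ} (X : Matrix (Fin T) (Fin T × Fin d) ℝ) :
    Matrix (Fin T) (Fin T × Fin d) ℝ :=
  Matrix.of fun i js => X js.1 (i, js.2)

/-- Squared Frobenius norm. -/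
noncomputable def frobSq {T d : ℕ} (M : Matrix (Fin T) (Fin T × Fin d) ℝ) : ℝ :=
  ∑ i, ∑ j, (M i j) ^ 2

/-- Operator (spectral) norm induced by Euclidean norms. -/
noncomputable def opNorm {T d : ℕ} (M : Matrix (Fin T) (Fin T × Fin d) ℝ) : ℝ :=
  ‖(Matrix.toEuclideanLin M).toContinuousLinearMap‖

/-- Effective rank (stable rank). -/
noncomputable def erank {T d : ℕ} (M : Matrix (Fin T) (Fin T × Fin d) ℝ) : ℝ :=
  frobSq M / (opNorm M) ^ 2

theorem aux_rank_sum {T d : ℕ} {ι : Type*} (s : Finset ι)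
    (B : ι → Matrix (Fin T) (Fin T × Fin d) ℝ) (r : ℕ) (h : ∀ i, (B i).rank ≤ r) :
    (∑ i ∈ s, B i).rank ≤ s.card * r := by
  classical
  induction s using Finset.induction_on with
  | empty => simp
  | insert a s ha ih =>
    rw [Finset.sum_insert ha, Finset.card_insert_of_notMem ha]
    have h2 : (B a + ∑ i ∈ s, B i).rank ≤ (B a).rank + (∑ i ∈ s, B i).rank := by
      unfold Matrix.rank
      rw [Matrix.mulVecLin_add]
      refine le_trans (Submodule.finrank_mono (LinearMap.range_add_le _ _)) ?_
      exact Submodule.finrank_add_le_finrank_add_finrank _ _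
    have := h a
    nlinarith

theorem aux_rank_blockT {T d : ℕ} (X : Matrix (Fin T) (Fin T × Fin d) ℝ) :
    (blockT X).rank ≤ X.rank * d := by
  have key : blockT X = ∑ s : Fin d, (X.submatrix id (fun i => (i, s))).transpose *
      (Matrix.of fun (j : Fin T) (js : Fin T × Fin d) =>
        if js.1 = j then (if js.2 = s then (1 : ℝ) else 0) else 0) := by
    ext i ⟨j, t⟩
    simp [blockT, Matrix.sum_apply, Matrix.mul_apply]
  rw [key]
  refine (aux_rank_sum _ _ X.rank fun s => ?_).trans (by simp [mul_comm])
  refine (Matrix.rank_mul_le_left _ _).trans ?_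
  rw [Matrix.rank_transpose]
  exact Matrix.rank_submatrix_le _ _ _

theorem aux_frobSq {T d : ℕ} (M : Matrix (Fin T) (Fin T × Fin d) ℝ) :
    frobSq M ≤ (M.rank : ℝ) * opNorm M ^ 2 := by
  classical
  have hH := Matrix.isHermitian_conjTranspose_mul_self M
  have htr : frobSq M = ∑ i, hH.eigenvalues i := by
    have h := hH.trace_eq_sum_eigenvalues
    simp only [RCLike.ofReal_real_eq_id, id] at h
    rw [← h]
    simp only [frobSq, Matrix.trace, Matrix.diag, Matrix.mul_apply, Matrix.conjTranspose_apply,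
      star_trivial]
    rw [Finset.sum_comm]
    simp only [sq]
  have hle : ∀ i, hH.eigenvalues i ≤ opNorm M ^ 2 := by
    intro i
    have hv := hH.mulVec_eigenvectorBasis i
    have hn := hH.eigenvectorBasis.orthonormal.1 i
    have he := hH.eigenvalues_eq i
    set v := hH.eigenvectorBasis i with hvdef
    have h1 := (Matrix.toEuclideanLin M).toContinuousLinearMap.le_opNorm v
    rw [hn, mul_one] at h1
    have h2 : hH.eigenvalues i = ‖(Matrix.toEuclideanLin M).toContinuousLinearMap v‖ ^ 2 := by
      rw [he, EuclideanSpace.real_norm_sq_eq]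
      simp only [star_trivial, RCLike.re_to_real, ← Matrix.mulVec_mulVec]
      rw [Matrix.dotProduct_mulVec, Matrix.conjTranspose_eq_transpose_of_trivial,
        Matrix.vecMul_transpose]
      simp [dotProduct, sq]
    rw [h2]
    exact pow_le_pow_left₀ (norm_nonneg _) h1 2
  have hr : (M.rank : ℝ) = ((Finset.univ.filter fun i => hH.eigenvalues i ≠ 0).card : ℝ) := by
    rw [← Matrix.rank_conjTranspose_mul_self M, hH.rank_eq_card_non_zero_eigs,
      Fintype.card_subtype]
  rw [htr, hr, ← Finset.sum_filter_ne_zero, ← nsmul_eq_mul]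
  exact Finset.sum_le_card_nsmul _ _ _ fun i _ => hle i

/-- If the block transpose of `X` is nonzero, then
`erank (𝒯 X) ≤ rank (𝒯 X) ≤ min (T, rank X · d)`. -/
theorem erank_blockT_le {T d : ℕ} (hT : 0 < T) (hd : 0 < d)
    (X : Matrix (Fin T) (Fin T × Fin d) ℝ) (hX : blockT X ≠ 0) :
    erank (blockT X) ≤ ((blockT X).rank : ℝ) ∧
      (blockT X).rank ≤ min T (X.rank * d) := by
  refine ⟨?_, le_min ((Matrix.rank_le_card_height _).trans (by simp)) (aux_rank_blockT X)⟩
  unfold erank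
  exact div_le_of_le_mul₀ (sq_nonneg _) (Nat.cast_nonneg _) (aux_frobSq _)
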